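/- There exists a set X ⊆ ℝ of cardinality exactly 𝔭 such that C_p(X) does not have the Pytkeev property. -/

import Mathlib

open Set Topology Filter

/-- The Pytkeev property of a topological space. -/
def PytkeevProp (Y : Type*) [TopologicalSpace Y] : Prop :=
  ∀ A : Set Y, ∀ y : Y, y ∈ closure A \ A →
    ∃ 𝒜 : ℕ → Set Y, (∀ n, (𝒜 n).Infinite ∧ 𝒜 n ⊆ A) ∧
      ∀ U ∈ nhds y, ∃ n, 𝒜 n ⊆ U

/-- Countable tightness. -/
def CountableTightness (Y : Type*) [TopologicalSpace Y] : Prop :=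
  ∀ A : Set Y, ∀ y ∈ closure A, ∃ B ⊆ A, B.Countable ∧ y ∈ closure B

/-- The Reznichenko property (weakly Fréchet-Urysohn). -/
def ReznichenkoProp (Y : Type*) [TopologicalSpace Y] : Prop :=
  ∀ A : Set Y, ∀ y : Y, y ∈ closure A \ A →
    ∃ F : ℕ → Set Y, (∀ n, F n ⊆ A ∧ (F n).Finite) ∧
      (∀ m n, m ≠ n → Disjoint (F m) (F n)) ∧
      ∀ U ∈ nhds y, ∀ᶠ n in Filter.atTop, (F n ∩ U).Nonempty

/-- `C_p(X)`: continuous real-valued functions on `X`, as a subspace of `ℝ^X`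
with the product (pointwise convergence) topology. -/
abbrev Cp (X : Type*) [TopologicalSpace X] : Type _ :=
  {f : X → ℝ // Continuous f}

/-- `C_p(X, S)`: continuous functions from `X` to `S ⊆ ℝ`, as a subspace of `ℝ^X`. -/
abbrev CpS (X : Type*) [TopologicalSpace X] (S : Set ℝ) : Type _ :=
  {f : X → ℝ // Continuous f ∧ ∀ x, f x ∈ S}

/-- `A` is a pseudo-intersection of `ℱ`: `A` is infinite and almost contained
in every member of `ℱ`. -/
def IsPseudoIntersection (A : Set ℕ) (ℱ : Set (Set ℕ)) : Prop :=
  A.Infinite ∧ ∀ B ∈ ℱ, (A \ B).Finite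

/-- A centered family in `[ℕ]^ω`: every nonempty finite subfamily has infinite
intersection (in particular all members are infinite). -/
def IsCentered (ℱ : Set (Set ℕ)) : Prop :=
  ∀ 𝒢 ⊆ ℱ, 𝒢.Finite → 𝒢.Nonempty → (⋂₀ 𝒢).Infinite

/-- The pseudo-intersection number 𝔭. -/
noncomputable def pNumber : Cardinal :=
  sInf { c : Cardinal | ∃ ℱ : Set (Set ℕ), IsCentered ℱ ∧
    (¬ ∃ A, IsPseudoIntersection A ℱ) ∧ Cardinal.mk ℱ = c }

/-- The cardinal 𝔭_σ. -/
noncomputable def pSigmaNumber : Cardinal :=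
  sInf { c : Cardinal | ∃ ℱ : Set (Set ℕ), IsCentered ℱ ∧
    (∀ 𝒬 : ℕ → Set (Set ℕ), (⋃ n, 𝒬 n) = ℱ →
      ∃ n, ¬ ∃ A, IsPseudoIntersection A (𝒬 n)) ∧ Cardinal.mk ℱ = c }

/-- A tower: a family in `[ℕ]^ω` linearly ordered by `⊆*` with no
pseudo-intersection. -/
def IsTower (ℱ : Set (Set ℕ)) : Prop :=
  (∀ A ∈ ℱ, A.Infinite) ∧
  (∀ A ∈ ℱ, ∀ B ∈ ℱ, (A \ B).Finite ∨ (B \ A).Finite) ∧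
  ¬ ∃ A, IsPseudoIntersection A ℱ

/-- The tower number 𝔱. -/
noncomputable def tNumber : Cardinal :=
  sInf { c : Cardinal | ∃ ℱ : Set (Set ℕ), IsTower ℱ ∧ Cardinal.mk ℱ = c }

/-- An ω-cover of `X`: `X` itself is not a member, and every finite subset of
`X` is contained in some member. -/
def IsOmegaCover {X : Type*} (𝒰 : Set (Set X)) : Prop :=
  Set.univ ∉ 𝒰 ∧ ∀ F : Set X, F.Finite → ∃ U ∈ 𝒰, F ⊆ U

/-- `⟨ℱ⟩`: the closure of `ℱ` under intersections of (nonempty) finite subfamilies. -/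
def FinInterClosure (ℱ : Set (Set ℕ)) : Set (Set ℕ) :=
  { S | ∃ 𝒢 ⊆ ℱ, 𝒢.Finite ∧ 𝒢.Nonempty ∧ S = ⋂₀ 𝒢 }

/-- A zero-dimensional space: the clopen sets form a base. -/
def ZeroDimensionalSpace (X : Type*) [TopologicalSpace X] : Prop :=
  ∀ x : X, ∀ U ∈ nhds x, ∃ V : Set X, IsClopen V ∧ x ∈ V ∧ V ⊆ U

/-- The set `S₀ = {1/n : n ∈ ℕ} ∪ {0} ⊆ ℝ`. -/
def Szero : Set ℝ := {x : ℝ | ∃ n : ℕ, x = 1 / (n + 1)} ∪ {0}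

/-- An ω-groupable family: it can be partitioned into finite pieces such that
every finite `F ⊆ X` is contained in some member of all but finitely many pieces. -/
def IsOmegaGroupable {X : Type*} (𝒰 : Set (Set X)) : Prop :=
  ∃ 𝒬 : Set (Set (Set X)), (∀ ℱ ∈ 𝒬, ℱ.Finite) ∧
    𝒬.PairwiseDisjoint id ∧ ⋃₀ 𝒬 = 𝒰 ∧
    ∀ F : Set X, F.Finite → { ℱ ∈ 𝒬 | ¬ ∃ U ∈ ℱ, F ⊆ U }.Finite

/-! ### Auxiliary notions -/

/-- almost inclusion -/
def AS (A B : Set ℕ) : Prop := (A \ B).Finite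

theorem AS.of_subset {A B : Set ℕ} (h : A ⊆ B) : AS A B := by
  unfold AS; rw [Set.sdiff_eq_empty.2 h]; exact Set.finite_empty

theorem AS.refl (A : Set ℕ) : AS A A := AS.of_subset subset_rfl

theorem AS.trans {A B C : Set ℕ} (h : AS A B) (h' : AS B C) : AS A C := by
  refine (Set.Finite.union h h').subset ?_
  rintro x ⟨hx, hc⟩
  by_cases hb : x ∈ B
  · exact Or.inr ⟨hb, hc⟩
  · exact Or.inl ⟨hx, hb⟩

theorem AS.inter {A B C : Set ℕ} (h : AS A B) (h' : AS A C) : AS A (B ∩ C) := by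
  refine (Set.Finite.union h h').subset ?_
  rintro x ⟨hx, hc⟩
  by_cases hb : x ∈ B
  · exact Or.inr ⟨hx, fun h => hc ⟨hb, h⟩⟩
  · exact Or.inl ⟨hx, hb⟩

theorem AS.inter_mono {A B C D : Set ℕ} (h : AS A B) (h' : AS C D) : AS (A ∩ C) (B ∩ D) :=
  AS.inter ((AS.of_subset Set.inter_subset_left).trans h)
    ((AS.of_subset Set.inter_subset_right).trans h')

theorem AS.infinite {A B : Set ℕ} (h : AS A B) (hA : A.Infinite) : B.Infinite := by
  intro hB
  refine hA ((Set.Finite.union h hB).subset ?_)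
  intro x hx
  by_cases hb : x ∈ B
  · exact Or.inr hb
  · exact Or.inl ⟨hx, hb⟩

/-- A bound for almost inclusion. -/
theorem AS.bound {A B : Set ℕ} (h : AS A B) : ∃ k, ∀ x ∈ A, k ≤ x → x ∈ B := by
  obtain ⟨k, hk⟩ := h.bddAbove
  refine ⟨k + 1, fun x hx hkx => ?_⟩
  by_contra hb
  have := hk ⟨hx, hb⟩
  omega

/-- directed families of infinite sets -/
def Dirc {κ : Type} (G : κ → Set ℕ) : Prop :=
  (∀ i, (G i).Infinite) ∧ ∀ i j, ∃ k, AS (G k) (G i) ∧ AS (G k) (G j)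

theorem Dirc.finite {κ : Type} {G : κ → Set ℕ} (hG : Dirc G) {𝒢 : Set (Set ℕ)}
    (hfin : 𝒢.Finite) : 𝒢 ⊆ range G → 𝒢.Nonempty → ∃ k, AS (G k) (⋂₀ 𝒢) := by
  induction 𝒢, hfin using Set.Finite.induction_on with
  | empty => intro _ h; exact absurd h Set.not_nonempty_empty
  | @insert a s _ _ ih =>
    intro hs _
    obtain ⟨i, rfl⟩ := hs (Set.mem_insert _ _)
    rw [Set.sInter_insert]
    rcases s.eq_empty_or_nonempty with rfl | hne
    · exact ⟨i, by simpa using AS.refl _⟩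
    · obtain ⟨j, hj⟩ := ih ((Set.subset_insert _ _).trans hs) hne
      obtain ⟨k, h1, h2⟩ := hG.2 i j
      exact ⟨k, h1.inter (h2.trans hj)⟩

theorem Dirc.centered {κ : Type} {G : κ → Set ℕ} (hG : Dirc G) : IsCentered (range G) := by
  intro 𝒢 h1 h2 h3
  obtain ⟨k, hk⟩ := hG.finite h2 h1 h3
  exact hk.infinite (hG.1 k)

theorem pint_of_lt {κ : Type} {G : κ → Set ℕ} (hG : Dirc G) (hκ : Cardinal.mk κ < pNumber) :
    ∃ A : Set ℕ, A.Infinite ∧ ∀ i, AS A (G i) := by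
  by_contra hcon
  have : pNumber ≤ Cardinal.mk (range G) := by
    refine csInf_le' ⟨range G, hG.centered, ?_, rfl⟩
    rintro ⟨A, hA, hA'⟩
    exact hcon ⟨A, hA, fun i => hA' _ (Set.mem_range_self i)⟩
  exact absurd (this.trans Cardinal.mk_range_le) (not_le.2 hκ)

theorem exists_split (A : Set ℕ) (hA : A.Infinite) :
    ∃ B ⊆ A, B.Infinite ∧ (A \ B).Infinite := by
  let f := hA.natEmbedding
  have hf : Function.Injective (fun n => (f n : ℕ)) :=
    Subtype.val_injective.comp f.injective
  refine ⟨range (fun n => (f (2 * n) : ℕ)), ?_, ?_, ?_⟩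
  · rintro _ ⟨n, rfl⟩; exact (f _).2
  · apply Set.infinite_range_of_injective
    intro a b h
    have := hf h
    omega
  · have : (range (fun n => (f (2 * n + 1) : ℕ))).Infinite := by
      apply Set.infinite_range_of_injective
      intro a b h
      have := hf h
      omega
    refine this.mono ?_
    rintro _ ⟨n, rfl⟩
    refine ⟨(f _).2, ?_⟩
    rintro ⟨m, hm⟩
    have := hf hm
    omega

theorem p_mem : ∃ ℱ : Set (Set ℕ), IsCentered ℱ ∧
    (¬ ∃ A, IsPseudoIntersection A ℱ) ∧ Cardinal.mk ℱ = pNumber := by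
  have : { c : Cardinal | ∃ ℱ : Set (Set ℕ), IsCentered ℱ ∧
    (¬ ∃ A, IsPseudoIntersection A ℱ) ∧ Cardinal.mk ℱ = c }.Nonempty := by
    refine ⟨_, {s | s ∈ hyperfilter ℕ}, ?_, ?_, rfl⟩
    · intro 𝒢 h1 h2 _ hfin
      have : ⋂₀ 𝒢 ∈ (hyperfilter ℕ : Filter ℕ) := (Filter.sInter_mem h2).2 fun s hs => h1 hs
      exact Filter.notMem_hyperfilter_of_finite hfin this
    · rintro ⟨A, hA, hA'⟩
      obtain ⟨B, hBA, hB, hB'⟩ := exists_split A hA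
      rcases (hyperfilter ℕ).mem_or_compl_mem B with h | h
      · exact hB' (hA' _ h)
      · refine hB ((hA' _ h).subset fun x hx => ⟨hBA hx, fun h => h hx⟩)
  exact csInf_mem this

theorem p_inf : Cardinal.aleph0 ≤ pNumber := by
  obtain ⟨ℱ, h1, h2, h3⟩ := p_mem
  by_contra hlt
  rw [not_le, ← h3, Cardinal.lt_aleph0_iff_set_finite] at hlt
  rcases ℱ.eq_empty_or_nonempty with rfl | hne
  · exact h2 ⟨univ, Set.infinite_univ, by simp⟩
  · refine h2 ⟨⋂₀ ℱ, h1 _ subset_rfl hlt hne, fun B hB => ?_⟩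
    exact AS.of_subset (Set.sInter_subset_of_mem hB)

/-- A directed family of size at most `p` without pseudo-intersection. -/
theorem p_dir : ∃ (κ : Type) (F : κ → Set ℕ), Cardinal.mk κ ≤ pNumber ∧ Dirc F ∧
    ¬ ∃ A : Set ℕ, A.Infinite ∧ ∀ i, AS A (F i) := by
  classical
  obtain ⟨ℱ, h1, h2, h3⟩ := p_mem
  have hinf : Infinite ℱ := by rw [Cardinal.infinite_iff, h3]; exact p_inf
  refine ⟨Finset ℱ, fun s => ⋂ i ∈ s, (i : Set ℕ), ?_, ⟨?_, ?_⟩, ?_⟩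
  · rw [Cardinal.mk_finset_of_infinite, h3]
  · intro s
    rcases s.eq_empty_or_nonempty with rfl | hne
    · simpa using Set.infinite_univ
    · have := h1 (Subtype.val '' (s : Set ℱ)) (by rintro _ ⟨x, _, rfl⟩; exact x.2)
        (s.finite_toSet.image _) (by simpa using hne)
      rwa [Set.sInter_image] at this
  · intro s t
    refine ⟨s ∪ t, AS.of_subset ?_, AS.of_subset ?_⟩
    · exact Set.biInter_subset_biInter_left (by simp)
    · exact Set.biInter_subset_biInter_left (by simp)
  · rintro ⟨A, hA, hA'⟩
    refine h2 ⟨A, hA, fun B hB => ?_⟩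
    change AS A B
    simpa using hA' {⟨B, hB⟩}

/-- domination for families indexed by `κ` -/
def Dom (κ : Type) : Prop :=
  ∀ f : κ → ℕ → ℕ, ∃ h : ℕ → ℕ, ∀ i, ∃ k, ∀ n, k ≤ n → f i n ≤ h n

theorem dom_unit : Dom Unit := fun f => ⟨f (), fun _ => ⟨0, fun _ _ => le_rfl⟩⟩

theorem Dom.of_le {κ : Type} (h : ∀ κ : Type, Cardinal.mk κ ≤ pNumber → Dom κ)
    (hk : Cardinal.mk κ ≤ pNumber) : Dom κ := h κ hk

/-- countable families have positive pseudo-intersections -/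
theorem count_pos {κ : Type} (hD : Dom κ) (R : ℕ → Set ℕ) (G : κ → Set ℕ)
    (h : ∀ n i, (G i ∩ ⋂ m ≤ n, R m).Infinite) :
    ∃ Q : Set ℕ, (∀ n, AS Q (R n)) ∧ ∀ i, (G i ∩ Q).Infinite := by
  have h' : ∀ i n, ∃ x, x ∈ G i ∩ ⋂ m ≤ n, R m ∧ n < x := fun i n => by
    obtain ⟨x, hx, hn⟩ := (h n i).exists_gt n
    exact ⟨x, hx, hn⟩
  choose g hg hgn using h'
  obtain ⟨H, hH⟩ := hD g
  refine ⟨{x | ∃ k, x ∈ (⋂ m ≤ k, R m) ∧ x ≤ H k}, ?_, ?_⟩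
  · intro n
    refine (Set.Finite.subset (Set.Finite.biUnion (Set.finite_lt_nat n)
      fun k _ => Set.finite_le_nat (H k))) ?_
    rintro x ⟨⟨k, hk, hxk⟩, hxn⟩
    simp only [Set.mem_iUnion]
    refine ⟨k, ?_, hxk⟩
    by_contra hlt
    simp only [Set.mem_ofPred_eq, not_lt] at hlt
    simp only [Set.mem_iInter] at hk
    exact hxn (hk n hlt)
  · intro i
    obtain ⟨k, hk⟩ := hH i
    refine Set.infinite_of_not_bddAbove ?_
    rintro ⟨B, hB⟩
    have hm := hB (a := g i (max k B)) ⟨(hg i _).1, max k B, (hg i _).2, hk _ (le_max_left _ _)⟩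
    have := hgn i (max k B)
    omega

/-- filling between countably many sets and a dominated family -/
theorem fill {κ : Type} (hD : Dom κ) (N : Set ℕ) (A : ℕ → Set ℕ) (P : κ → Set ℕ)
    (hP : ∀ n ∈ N, ∀ i, AS (A n) (P i)) :
    ∃ Q : Set ℕ, (∀ i, AS Q (P i)) ∧ ∀ n ∈ N, AS (A n) Q := by
  have : ∀ i n, ∃ k, n ∈ N → ∀ x ∈ A n, k ≤ x → x ∈ P i := fun i n => by
    by_cases hn : n ∈ N
    · obtain ⟨k, hk⟩ := (hP n hn i).bound
      exact ⟨k, fun _ => hk⟩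
    · exact ⟨0, fun h => absurd h hn⟩
  choose f hf using this
  obtain ⟨H, hH⟩ := hD f
  refine ⟨{x | ∃ n ∈ N, x ∈ A n ∧ H n ≤ x}, ?_, ?_⟩
  · intro i
    obtain ⟨k, hk⟩ := hH i
    refine Set.Finite.subset (Set.Finite.biUnion (Set.finite_lt_nat k)
      fun n _ => Set.finite_lt_nat (f i n)) ?_
    rintro x ⟨⟨n, hn, hx, hHx⟩, hxP⟩
    simp only [Set.mem_iUnion, Set.mem_ofPred_eq]
    refine ⟨n, ?_, ?_⟩
    · by_contra hlt
      exact hxP (hf i n hn x hx ((hk n (not_lt.1 hlt)).trans hHx))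
    · by_contra hlt
      exact hxP (hf i n hn x hx (not_lt.1 hlt))
  · intro n hn
    refine (Set.finite_lt_nat (H n)).subset ?_
    rintro x ⟨hx, hx'⟩
    by_contra hlt
    exact hx' ⟨n, hn, hx, not_lt.1 hlt⟩

theorem exists_order (κ : Type) : ∃ (_ : LinearOrder κ) (_ : WellFoundedLT κ),
    ∀ a : κ, Cardinal.mk {b // b < a} < Cardinal.mk κ := by
  obtain ⟨l, w, h⟩ := Cardinal.exists_ord_eq_type_lt κ
  refine ⟨l, w, fun a => ?_⟩
  have := Cardinal.card_typein_lt (r := (· < ·)) a h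
  simpa using this

/-- transfinite construction of towers -/
theorem rec_tower {κ : Type} [LinearOrder κ] [WellFoundedLT κ] (C : κ → Set ℕ → Prop)
    (h : ∀ (a : κ) (P : κ → Set ℕ), (∀ b < a, C b (P b) ∧ ∀ c < b, AS (P b) (P c)) →
      ∃ Q, C a Q ∧ ∀ b < a, AS Q (P b)) :
    ∃ P : κ → Set ℕ, ∀ a, C a (P a) ∧ ∀ b < a, AS (P a) (P b) := by
  classical
  let step : (a : κ) → ((b : κ) → b < a → Set ℕ) → Set ℕ := fun a p =>
    if hx : ∃ Q, C a Q ∧ ∀ b (hb : b < a), AS Q (p b hb) then hx.choose else univ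
  let P : κ → Set ℕ := (wellFounded_lt (α := κ)).fix step
  refine ⟨P, fun a => ?_⟩
  induction a using (wellFounded_lt (α := κ)).induction with
  | _ a ih =>
    have hx := h a P ih
    have hPa : P a = step a (fun b _ => P b) := (wellFounded_lt (α := κ)).fix_eq step a
    have : P a = hx.choose := by
      rw [hPa]
      exact dif_pos hx
    rw [this]
    exact hx.choose_spec

/-- The hypothesis to refute: all directed families of size at most `p` have a countable witness. -/
def Hyp : Prop := ∀ κ : Type, Cardinal.mk κ ≤ pNumber → ∀ G : κ → Set ℕ, Dirc G →
  ∃ A : ℕ → Set ℕ, (∀ n, (A n).Infinite) ∧ ∀ i, ∃ n, AS (A n) (G i)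

theorem AS.of_le {κ : Type} [LinearOrder κ] {P : κ → Set ℕ} {a b : κ}
    (h : ∀ b < a, AS (P a) (P b)) (hab : b ≤ a) : AS (P a) (P b) := by
  rcases hab.lt_or_eq with h1 | rfl
  · exact h _ h1
  · exact AS.refl _

theorem tower_iInter {κ : Type} [LinearOrder κ] {P : κ → Set ℕ} (T : κ → Prop)
    (h2 : ∀ a, T a → ∀ b < a, AS (P a) (P b)) (s : ℕ → κ) (hs : ∀ n, T (s n)) (n : ℕ) :
    ∃ a, T a ∧ AS (P a) (⋂ m ≤ n, P (s m)) := by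
  induction n with
  | zero => exact ⟨s 0, hs 0, by simpa using AS.refl _⟩
  | succ n ih =>
    obtain ⟨a, hT, ha⟩ := ih
    have e : (⋂ m ≤ n + 1, P (s m)) = (⋂ m ≤ n, P (s m)) ∩ P (s (n + 1)) := by
      ext x
      simp only [Set.mem_iInter, Set.mem_inter_iff]
      constructor
      · intro h; exact ⟨fun i hi => h i (by omega), h _ le_rfl⟩
      · rintro ⟨h, h'⟩ i hi
        rcases Nat.le_succ_iff.1 hi with hi | rfl
        · exact h i hi
        · exact h'
    rw [e]
    rcases le_total a (s (n + 1)) with hle | hle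
    · exact ⟨_, hs _, ((AS.of_le (h2 _ (hs _)) hle).trans ha).inter (AS.refl _)⟩
    · exact ⟨a, hT, ha.inter (AS.of_le (h2 _ hT) hle)⟩

/-- Under `Hyp`, towers of length at most `p` have pseudo-intersections. -/
theorem tower_pint (H : Hyp) {κ : Type} [LinearOrder κ] (hκ : Cardinal.mk κ ≤ pNumber)
    (P : κ → Set ℕ) (h1 : ∀ a, (P a).Infinite) (h2 : ∀ a, ∀ b < a, AS (P a) (P b)) :
    ∃ A : Set ℕ, A.Infinite ∧ ∀ i, AS A (P i) := by
  by_contra hcon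
  obtain ⟨A, hA, hA'⟩ := H κ hκ P ⟨h1, fun i j =>
    ⟨max i j, AS.of_le (h2 _) (le_max_left _ _), AS.of_le (h2 _) (le_max_right _ _)⟩⟩
  have : ∀ n, ∃ a, ¬ AS (A n) (P a) := fun n => by
    by_contra! hn
    exact hcon ⟨A n, hA n, hn⟩
  choose s hs using this
  by_cases hb : ∃ a, ∀ n, s n ≤ a
  · obtain ⟨a, ha⟩ := hb
    obtain ⟨n, hn⟩ := hA' a
    exact hs n (hn.trans (AS.of_le (h2 _) (ha n)))
  · push Not at hb
    obtain ⟨Q, hQ, hQ'⟩ := count_pos dom_unit (fun n => P (s n)) (fun _ => univ) (fun n _ => by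
      obtain ⟨a, -, ha⟩ := tower_iInter (fun _ => True) (fun a _ => h2 a) s (fun _ => trivial) n
      rw [Set.univ_inter]
      exact ha.infinite (h1 a))
    refine hcon ⟨Q, by simpa using hQ' (), fun i => ?_⟩
    obtain ⟨n, hn⟩ := hb i
    exact (hQ n).trans (h2 _ _ hn)

theorem exists_sparse (Q : Set ℕ) (hQ : Q.Infinite) (f : ℕ → ℕ) :
    ∃ R ⊆ Q, R.Infinite ∧ ∀ a ∈ R, ∀ b ∈ R, a < b → ∀ i ≤ a, f i ≤ b := by
  have : ∀ a, ∃ b ∈ Q, a < b ∧ ∀ i ≤ a, f i ≤ b := fun a => by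
    obtain ⟨b, hb, hlt⟩ := hQ.exists_gt (a + ∑ i ∈ Finset.range (a + 1), f i)
    refine ⟨b, hb, by omega, fun i hi => ?_⟩
    have := Finset.single_le_sum (f := f) (fun _ _ => Nat.zero_le _)
      (Finset.mem_range.2 (Nat.lt_succ_of_le hi))
    simp only [Nat.succ_eq_add_one] at this
    omega
  choose g hgQ hg hgf using this
  let q : ℕ → ℕ := fun n => g^[n + 1] 0
  have hq : ∀ n, q (n + 1) = g (q n) := fun n => Function.iterate_succ_apply' g (n + 1) 0
  have hmono : StrictMono q := strictMono_nat_of_lt_succ fun n => by rw [hq]; exact hg _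
  refine ⟨range q, ?_, Set.infinite_range_of_injective hmono.injective, ?_⟩
  · rintro _ ⟨n, rfl⟩
    have : q n = g (g^[n] 0) := Function.iterate_succ_apply' g n 0
    rw [this]; exact hgQ _
  · rintro _ ⟨m, rfl⟩ _ ⟨n, rfl⟩ hlt i hi
    have hmn : m + 1 ≤ n := hmono.lt_iff_lt.1 hlt
    exact ((hgf _ i hi).trans_eq (hq m).symm).trans (hmono.monotone hmn)

/-- Under `Hyp`, families of functions of size at most `p` are bounded. -/
theorem dom_of_hyp (H : Hyp) (κ : Type) (hκ : Cardinal.mk κ ≤ pNumber) : Dom κ := by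
  intro f
  obtain ⟨_, _, hord⟩ := exists_order κ
  obtain ⟨P, hP⟩ := rec_tower (κ := κ) (fun a Q => Q.Infinite ∧
      ∀ x ∈ Q, ∀ y ∈ Q, x < y → ∀ i ≤ x, f a i ≤ y) (by
    intro a P hP
    have hdir : Dirc (fun b : {b // b < a} => P b) :=
      ⟨fun b => (hP b b.2).1.1, fun b c =>
        ⟨max b c, AS.of_le (P := fun b : {b // b < a} => P b)
          (fun d hd => (hP _ (max b c).2).2 _ hd) (le_max_left _ _),
        AS.of_le (P := fun b : {b // b < a} => P b)
          (fun d hd => (hP _ (max b c).2).2 _ hd) (le_max_right _ _)⟩⟩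
    obtain ⟨Q, hQ, hQ'⟩ := pint_of_lt hdir ((hord a).trans_le hκ)
    obtain ⟨R, hRQ, hR, hR'⟩ := exists_sparse Q hQ (f a)
    exact ⟨R, ⟨hR, hR'⟩, fun b hb => (AS.of_subset hRQ).trans (hQ' ⟨b, hb⟩)⟩)
  obtain ⟨A, hA, hA'⟩ := tower_pint H hκ P (fun a => (hP a).1.1) (fun a => (hP a).2)
  choose g hgA hg using fun n => hA.exists_gt n
  refine ⟨fun n => g (g n), fun a => ?_⟩
  obtain ⟨k, hk⟩ := (hA' a).bound
  refine ⟨k, fun n hn => ?_⟩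
  have e1 := hg n
  have e2 := hg (g n)
  exact (hP a).1.2 (g n) (hk _ (hgA _) (by omega)) _ (hk _ (hgA _) (by omega)) e2 n (by omega)

theorem not_hyp : ¬ Hyp := by
  intro H
  obtain ⟨κ, F, hκ, hF, hno⟩ := p_dir
  obtain ⟨_, _, hord⟩ := exists_order κ
  obtain ⟨P, hP⟩ := rec_tower (κ := κ) (fun a Q => Q ⊆ F a ∧ ∀ i, (F i ∩ Q).Infinite) (by
    intro a P hP
    by_cases hne : ∃ b, b < a
    swap
    · refine ⟨F a, ⟨subset_rfl, fun i => ?_⟩, fun b hb => absurd ⟨b, hb⟩ hne⟩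
      obtain ⟨k, h1, h2⟩ := hF.2 i a
      exact (h1.inter h2).infinite (hF.1 k)
    have hlt : Cardinal.mk {b // b < a} ≤ pNumber := (hord a).le.trans hκ
    have hmono : ∀ b < a, ∀ c ≤ b, AS (P b) (P c) := fun b hb c hc =>
      AS.of_le (hP b hb).2 hc
    obtain ⟨A, hA, hA'⟩ := H (κ × {b // b < a})
      (by
        rw [Cardinal.mk_prod, Cardinal.lift_id, Cardinal.lift_id]
        exact (mul_le_mul' hκ hlt).trans_eq (Cardinal.mul_eq_self p_inf))
      (fun x => F x.1 ∩ P x.2)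
      ⟨fun x => (hP _ x.2.2).1.2 x.1, by
        rintro ⟨i, b, hb⟩ ⟨j, c, hc⟩
        obtain ⟨k, h1, h2⟩ := hF.2 i j
        exact ⟨⟨k, max b c, max_lt hb hc⟩,
          h1.inter_mono (hmono _ (max_lt hb hc) _ (le_max_left _ _)),
          h2.inter_mono (hmono _ (max_lt hb hc) _ (le_max_right _ _))⟩⟩
    let N : Set ℕ := {n | AS (A n) (F a) ∧ ∀ b < a, AS (A n) (P b)}
    by_cases hN : ∀ i, ∃ n ∈ N, AS (A n) (F i)
    · obtain ⟨Q, hQ, hQ'⟩ := fill (dom_of_hyp H _ hlt) N A (fun b : {b // b < a} => P b)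
        (fun n hn b => hn.2 b b.2)
      refine ⟨F a ∩ Q, ⟨Set.inter_subset_left, fun i => ?_⟩, fun b hb =>
        (AS.of_subset Set.inter_subset_right).trans (hQ ⟨b, hb⟩)⟩
      obtain ⟨n, hn, hni⟩ := hN i
      exact (hni.inter (hn.1.inter (hQ' n hn))).infinite (hA n)
    · push Not at hN
      obtain ⟨i, hi⟩ := hN
      obtain ⟨k, hki, hka⟩ := hF.2 i a
      have : ∀ n, ∃ b, b < a ∧ (AS (A n) (F k) → ¬ AS (A n) (P b)) := fun n => by
        by_cases hn : AS (A n) (F k)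
        · by_contra! hcon
          exact hi n ⟨hn.trans hka, fun b hb => (hcon b hb).2⟩ (hn.trans hki)
        · obtain ⟨b, hb⟩ := hne
          exact ⟨b, hb, fun h => absurd h hn⟩
      choose s hsa hs using this
      obtain ⟨Q, hQ, hQ'⟩ := count_pos (dom_of_hyp H κ hκ) (fun n => P (s n))
        (fun j => F j ∩ F a) (fun n j => by
          obtain ⟨c, hca, hc⟩ := tower_iInter (fun b => b < a) (fun b hb => (hP b hb).2) s hsa n
          obtain ⟨l, h1, h2⟩ := hF.2 j a
          exact ((h1.inter h2).inter_mono hc).infinite ((hP c hca).1.2 l))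
      refine ⟨F a ∩ Q, ⟨Set.inter_subset_left, fun j => ?_⟩, fun b hb => ?_⟩
      · rw [← Set.inter_assoc]; exact hQ' j
      · obtain ⟨n, hn⟩ := hA' ⟨k, b, hb⟩
        have h1 : AS (A n) (F k) := hn.trans (AS.of_subset Set.inter_subset_left)
        have h2 : AS (A n) (P b) := hn.trans (AS.of_subset Set.inter_subset_right)
        have h3 : b ≤ s n := by
          by_contra hlt
          exact hs n h1 (h2.trans (hmono b hb _ (not_le.1 hlt).le))
        exact ((AS.of_subset Set.inter_subset_right).trans (hQ n)).trans
          (hmono _ (hsa n) _ h3))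
  obtain ⟨A, hA, hA'⟩ := tower_pint H hκ P
    (fun a => ((hP a).1.2 a).mono Set.inter_subset_right) (fun a => (hP a).2)
  exact hno ⟨A, hA, fun i => (hA' i).trans (AS.of_subset (hP i).1.1)⟩

/-- the point of the Cantor set coding a set of natural numbers -/
noncomputable def code (S : Set ℕ) : ℝ :=
  Subtype.val (cantorSetHomeomorphNatToBool.symm
    (fun n => @decide (n ∈ S) (Classical.propDecidable _)))

theorem code_mem (S : Set ℕ) : code S ∈ cantorSet := Subtype.coe_prop _

theorem code_dec (S : Set ℕ) (n : ℕ) :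
    cantorSetHomeomorphNatToBool ⟨code S, code_mem S⟩ n = true ↔ n ∈ S := by
  classical
  simp [code]

theorem code_inj : Function.Injective code := by
  intro S T h
  ext n
  rw [← code_dec S, ← code_dec T]
  simp only [h]

theorem pytkeev_fail {κ : Type} (G : κ → Set ℕ) (hG : Dirc G) [Nonempty κ]
    (hno : ¬ ∃ A : ℕ → Set ℕ, (∀ n, (A n).Infinite) ∧ ∀ i, ∃ n, AS (A n) (G i)) :
    ¬ PytkeevProp (Cp (code '' range G : Set ℝ)) := by
  intro hpyt
  let X : Set ℝ := code '' range G
  have hX : ∀ x : X, (x : ℝ) ∈ cantorSet := by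
    rintro ⟨_, S, _, rfl⟩; exact code_mem S
  let d : X → ℕ → Bool := fun x => cantorSetHomeomorphNatToBool ⟨x, hX x⟩
  have hd : Continuous d := by
    refine cantorSetHomeomorphNatToBool.continuous.comp ?_
    exact Continuous.subtype_mk continuous_subtype_val _
  let φ : ℕ → Bool → ℝ := fun n b => (if b then 0 else 1) + 1 / ((n : ℝ) + 1)
  let f : ℕ → Cp X := fun n => ⟨fun x => φ n (d x n),
    (continuous_of_discreteTopology (f := φ n)).comp ((continuous_apply n).comp hd)⟩
  let z : Cp X := ⟨fun _ => 0, continuous_const⟩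
  let pt : κ → X := fun i => ⟨code (G i), G i, Set.mem_range_self i, rfl⟩
  have hpt : ∀ i n, d (pt i) n = true ↔ n ∈ G i := fun i n => code_dec (G i) n
  have hpos : ∀ n : ℕ, (0 : ℝ) < 1 / ((n : ℝ) + 1) := fun n => by positivity
  have hz : z ∈ closure (range f) \ range f := by
    constructor
    · rw [mem_closure_iff_nhds]
      intro U hU
      rw [nhds_induced, Filter.mem_comap] at hU
      obtain ⟨V, hV, hVU⟩ := hU
      change V ∈ 𝓝 (fun _ : X => (0 : ℝ)) at hV
      rw [nhds_pi, Filter.mem_pi] at hV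
      obtain ⟨I, hI, t, ht, htV⟩ := hV
      have hev : ∀ᶠ n : ℕ in atTop, ∀ x ∈ I, 1 / ((n : ℝ) + 1) ∈ t x := by
        rw [Filter.eventually_all_finite hI]
        intro x _
        exact tendsto_one_div_add_atTop_nhds_zero_nat (ht x)
      obtain ⟨M, hM⟩ := Filter.eventually_atTop.1 hev
      have hinf : {n | ∀ x ∈ I, d x n = true}.Infinite := by
        have key : ∃ k, AS (G k) (⋂₀ {S | ∃ i, S = G i ∧ ∃ x ∈ I, x = pt i}) ∨ I = ∅ := by
          rcases I.eq_empty_or_nonempty with h | ⟨x, hx⟩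
          · exact ⟨Classical.arbitrary κ, Or.inr h⟩
          · have hfin : {S | ∃ i, S = G i ∧ ∃ x ∈ I, x = pt i}.Finite := by
              have : (code ⁻¹' (Subtype.val '' I)).Finite :=
                (hI.image _).preimage code_inj.injOn
              refine this.subset ?_
              rintro S ⟨i, rfl, x, hx, rfl⟩
              exact ⟨pt i, hx, rfl⟩
            obtain ⟨k, hk⟩ := hG.finite hfin (by rintro S ⟨i, rfl, _⟩; exact ⟨i, rfl⟩) (by
              obtain ⟨_, _, ⟨i, rfl⟩, rfl⟩ := x
              exact ⟨G i, i, rfl, _, hx, rfl⟩)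
            exact ⟨k, Or.inl hk⟩
        obtain ⟨k, hk | rfl⟩ := key
        · refine (hk.infinite (hG.1 k)).mono ?_
          rintro n hn ⟨_, _, ⟨i, rfl⟩, rfl⟩ hx
          exact (hpt i n).2 (hn _ ⟨i, rfl, _, hx, rfl⟩)
        · simpa using Set.infinite_univ
      obtain ⟨n, hn, hMn⟩ := hinf.exists_gt M
      refine ⟨f n, hVU (htV ?_), n, rfl⟩
      intro x hx
      have : (f n).1 x = 1 / ((n : ℝ) + 1) := by simp [f, φ, hn x hx]
      rw [this]
      exact hM n hMn.le x hx
    · rintro ⟨n, hn⟩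
      have h1 : (f n).1 (pt (Classical.arbitrary κ)) = 0 := by rw [hn]
      have h2 : 0 < (f n).1 (pt (Classical.arbitrary κ)) := by
        have := hpos n
        simp only [f, φ]
        split_ifs <;> linarith
      linarith
  obtain ⟨𝒜, h𝒜, hU⟩ := hpyt (range f) z hz
  refine hno ⟨fun n => f ⁻¹' 𝒜 n, fun n => ?_, fun i => ?_⟩
  · intro hfin
    refine (h𝒜 n).1 ((hfin.image f).subset ?_)
    rw [Set.image_preimage_eq_of_subset (h𝒜 n).2]
  · obtain ⟨n, hn⟩ := hU {g | g.1 (pt i) < 1} (by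
      refine IsOpen.mem_nhds ?_ (by simp [z])
      exact isOpen_lt ((continuous_apply (pt i)).comp continuous_subtype_val) continuous_const)
    refine ⟨n, AS.of_subset fun m hm => ?_⟩
    have h1 : (f m).1 (pt i) < 1 := hn hm
    rw [← hpt i m]
    by_contra hne
    have := hpos m
    simp only [f, φ, hne] at h1
    simp at h1
    simp at this
    linarith

/-- there is a set of reals of cardinality exactly 𝔭 whose
`C_p` does not have the Pytkeev property. -/
theorem statement10 :
    ∃ X : Set ℝ, Cardinal.mk X = pNumber ∧ ¬ PytkeevProp (Cp X) := by
  have hn := not_hyp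
  unfold Hyp at hn
  push Not at hn
  obtain ⟨κ, hκ, G, hG, hno⟩ := hn
  have hno' : ¬ ∃ A : ℕ → Set ℕ, (∀ n, (A n).Infinite) ∧ ∀ i, ∃ n, AS (A n) (G i) := by
    rintro ⟨A, hA, hA'⟩
    obtain ⟨i, hi⟩ := hno A hA
    obtain ⟨n, hn⟩ := hA' i
    exact hi n hn
  have hne : Nonempty κ := by
    by_contra hemp
    exact hno' ⟨fun _ => univ, fun _ => Set.infinite_univ, fun i => absurd ⟨i⟩ hemp⟩
  refine ⟨code '' range G, ?_, pytkeev_fail G hG hno'⟩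
  rw [Cardinal.mk_image_eq code_inj]
  refine le_antisymm (Cardinal.mk_range_le.trans hκ) ?_
  refine csInf_le' ⟨range G, hG.centered, ?_, rfl⟩
  rintro ⟨A, hA, hA'⟩
  exact hno' ⟨fun _ => A, fun _ => hA, fun i => ⟨0, hA' _ (Set.mem_range_self i)⟩⟩
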